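/- arXiv:2605.21259 — 9 statements merged into one kernel-verified Lean document; each statement's English description precedes it below -/
import Mathlib

section
/- Let A be a type and let S be a nonempty family of subsets of A such that every X ∈ S has a proper subset Y ⊊ X with Y ∈ S. Then there exists a function F : S → Bool such that for every X ∈ S, F is not constant on the family {Y ∈ S : Y ⊆ X} (i.e. no member of S is homogeneous for F). -/
/-- Two points are related when their forward orbits under `f` meet. -/
def orbitMeetSetoid {α : Type*} (f : α → α) : Setoid α where
  r x y := ∃ n m : ℕ, f^[n] x = f^[m] y
  iseqv :=
    { refl := fun _ => ⟨0, 0, rfl⟩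
      symm := fun ⟨n, m, h⟩ => ⟨m, n, h.symm⟩
      trans := by
        rintro x y z ⟨n, m, h⟩ ⟨k, l, h'⟩
        refine ⟨k + n, m + l, ?_⟩
        rw [Function.iterate_add_apply, h, ← Function.iterate_add_apply, add_comm k m,
          Function.iterate_add_apply, h', ← Function.iterate_add_apply] }

/-- If the forward orbits of `x` and `r` meet and the orbit of `r` is injective, then the offset
between the two orbits is well defined. -/
theorem add_eq_add_of_iterate_eq {α : Type*} {f : α → α} {x r : α}
    (hr : Function.Injective fun k : ℕ => f^[k] r) {n m n' m' : ℕ}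
    (h : f^[n] x = f^[m] r) (h' : f^[n'] x = f^[m'] r) : n' + m = n + m' := by
  apply hr
  change f^[n' + m] r = f^[n + m'] r
  rw [Function.iterate_add_apply, ← h, Function.iterate_add_apply, ← h',
    ← Function.iterate_add_apply, ← Function.iterate_add_apply, add_comm]

/-- A self-map without periodic orbits admits a 2-colouring that it alternates. -/
theorem exists_bool_coloring_of_injective_iterate {α : Type*} (f : α → α)
    (hf : ∀ x, Function.Injective fun k : ℕ => f^[k] x) :
    ∃ F : α → Bool, ∀ x, F (f x) ≠ F x := by
  classical
  let r : α → α := fun x => (Quotient.mk (orbitMeetSetoid f) x).out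
  have hmeet : ∀ x, ∃ n m : ℕ, f^[n] x = f^[m] (r x) := fun x =>
    (orbitMeetSetoid f).symm (Quotient.mk_out (s := orbitMeetSetoid f) x)
  have hr : ∀ x, r (f x) = r x := fun x =>
    congrArg Quotient.out (Quotient.sound (s := orbitMeetSetoid f) ⟨0, 1, rfl⟩)
  choose n m h using hmeet
  refine ⟨fun x => decide (Even (n x + m x)), fun x hx => ?_⟩
  have hfx : f^[n (f x) + 1] x = f^[m (f x)] (r x) := by
    rw [Function.iterate_succ_apply, h, hr]
  have hoff := add_eq_add_of_iterate_eq (hf (r x)) (h x) hfx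
  have hpar := decide_eq_decide.mp hx
  simp only [Nat.even_iff] at hpar
  omega

/-- Proposition 1.1 (combinatorial content): if `S` is a nonempty family of
subsets of `A` in which every member has a proper sub-member, then there is a
2-colouring `F : S → Bool` with no homogeneous member, i.e. for every `X ∈ S`,
`F` is not constant on `{Y ∈ S : Y ⊆ X}`. -/
theorem stmt_0 {A : Type*} (S : Set (Set A)) (hne : S.Nonempty)
    (hsub : ∀ X ∈ S, ∃ Y ∈ S, Y ⊂ X) :
    ∃ F : S → Bool, ∀ X : S, ¬ ∀ Y Z : S, (Y : Set A) ⊆ (X : Set A) →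
      (Z : Set A) ⊆ (X : Set A) → F Y = F Z := by
  choose f hfS hf using hsub
  let g : S → S := fun X => ⟨f X X.2, hfS X X.2⟩
  have hg : ∀ X, g X < X := fun X => hf X X.2
  obtain ⟨F, hF⟩ := exists_bool_coloring_of_injective_iterate g fun X =>
    (strictAnti_nat_of_succ_lt fun k => by
      rw [Function.iterate_succ_apply']
      exact hg _).injective
  exact ⟨F, fun X hX => hF X (hX (g X) X (hg X).le subset_rfl)⟩
end

section
/- Let A be a type, S a nonempty family of subsets of A, and D ⊆ S dense in S, meaning that every X ∈ S has some Y ∈ D with Y ⊆ X. Suppose F : D → Bool is such that every X ∈ D has some Y ∈ D with Y ⊆ X and F(Y) ≠ F(X). Then there exists F' : S → Bool agreeing with F on D such that for every X ∈ S, F' is not constant on {Y ∈ S : Y ⊆ X} (i.e. no member of S is homogeneous for F'). -/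
/-- Observation in Section 3: a colouring of a dense subfamily `D ⊆ S` with no
homogeneous member (in the strong sense that every member of `D` has a
sub-member in `D` of the other colour) extends to a colouring of all of `S`
with no homogeneous member. -/
theorem stmt_2 {A : Type*} (S D : Set (Set A)) (hne : S.Nonempty) (hDS : D ⊆ S)
    (hdense : ∀ X ∈ S, ∃ Y ∈ D, Y ⊆ X)
    (F : D → Bool)
    (hF : ∀ X : D, ∃ Y : D, (Y : Set A) ⊆ (X : Set A) ∧ F Y ≠ F X) :
    ∃ F' : S → Bool,
      (∀ (Y : Set A) (hY : Y ∈ D), F' ⟨Y, hDS hY⟩ = F ⟨Y, hY⟩) ∧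
      ∀ X : S, ¬ ∀ Y Z : S, (Y : Set A) ⊆ (X : Set A) →
        (Z : Set A) ⊆ (X : Set A) → F' Y = F' Z := by
  classical
  let F' : S → Bool := fun X => if h : (X : Set A) ∈ D then F ⟨X, h⟩ else true
  have hF' (Y : Set A) (hY : Y ∈ D) : F' ⟨Y, hDS hY⟩ = F ⟨Y, hY⟩ := dif_pos hY
  refine ⟨F', hF', fun X hX => ?_⟩
  obtain ⟨Y, hY, hYX⟩ := hdense X X.2
  obtain ⟨⟨Z, hZ⟩, hZY, hne'⟩ := hF ⟨Y, hY⟩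
  have h := hX ⟨Z, hDS hZ⟩ ⟨Y, hDS hY⟩ (hZY.trans hYX) hYX
  rw [hF' Z hZ, hF' Y hY] at h
  exact hne' h
end

section
/- Let ≺ be an arbitrary linear order on ℚ and let < denote the usual order on ℚ. Then there exists a subset A ⊆ ℚ with (A, <) order-isomorphic to ℚ satisfying at least one of the following: (1) (A, ≺) is order-isomorphic to ℕ; (2) (A, ≺) is order-isomorphic to ℕᵒᵈ (the reverse of ℕ); (3) for all a, b ∈ A, a ≺ b ↔ a < b; (4) for all a, b ∈ A, a ≺ b ↔ b < a. -/
open Set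

/-- A set of rationals is non-scattered if it contains a copy of `ℚ`. -/
def NonScattered (S : Set ℚ) : Prop :=
  ∃ f : ℚ → ℚ, StrictMono f ∧ ∀ x, f x ∈ S

theorem nonempty_orderIso_rat (A : Set ℚ) (hne : A.Nonempty)
    (hmin : ∀ x ∈ A, ∃ y ∈ A, y < x) (hmax : ∀ x ∈ A, ∃ y ∈ A, x < y)
    (hdense : ∀ x ∈ A, ∀ y ∈ A, x < y → ∃ z ∈ A, x < z ∧ z < y) : Nonempty (A ≃o ℚ) := by
  have : Nonempty A := hne.to_subtype
  have : NoMinOrder A :=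
    ⟨fun a => let ⟨y, hy, h⟩ := hmin a a.2; ⟨⟨y, hy⟩, h⟩⟩
  have : NoMaxOrder A :=
    ⟨fun a => let ⟨y, hy, h⟩ := hmax a a.2; ⟨⟨y, hy⟩, h⟩⟩
  have : DenselyOrdered A :=
    ⟨fun a b hab => let ⟨z, hz, h⟩ := hdense a a.2 b b.2 hab; ⟨⟨z, hz⟩, h⟩⟩
  exact Order.iso_of_countable_dense A ℚ

theorem nonempty_orderIso_rat_of_meets_Ioo (A : Set ℚ)
    (h : ∀ p q : ℚ, p < q → ∃ x ∈ A, p < x ∧ x < q) : Nonempty (A ≃o ℚ) := by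
  refine nonempty_orderIso_rat A ?_ ?_ ?_ fun x _ y _ => h x y
  · obtain ⟨x, hx, -⟩ := h 0 1 one_pos
    exact ⟨x, hx⟩
  · intro x _
    obtain ⟨y, hy, -, h⟩ := h (x - 1) x (by linarith)
    exact ⟨y, hy, h⟩
  · intro x _
    obtain ⟨y, hy, h, -⟩ := h x (x + 1) (by linarith)
    exact ⟨y, hy, h⟩

theorem nonempty_orderIso_rat_Ioo {p q : ℚ} (hpq : p < q) : Nonempty (Ioo p q ≃o ℚ) := by
  refine nonempty_orderIso_rat _ (nonempty_Ioo.2 hpq) ?_ ?_ ?_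
  · rintro x ⟨hp, hq⟩
    obtain ⟨y, h₁, h₂⟩ := exists_between hp
    exact ⟨y, ⟨h₁, h₂.trans hq⟩, h₂⟩
  · rintro x ⟨hp, hq⟩
    obtain ⟨y, h₁, h₂⟩ := exists_between hq
    exact ⟨y, ⟨hp.trans h₁, h₂⟩, h₁⟩
  · rintro x ⟨hp, -⟩ y ⟨-, hq⟩ hxy
    obtain ⟨z, h₁, h₂⟩ := exists_between hxy
    exact ⟨z, ⟨hp.trans h₁, h₂.trans hq⟩, h₁, h₂⟩

namespace NonScattered

theorem univ : NonScattered univ :=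
  ⟨id, strictMono_id, fun _ => mem_univ _⟩

theorem nonempty {S : Set ℚ} (hS : NonScattered S) : S.Nonempty :=
  let ⟨f, _, h⟩ := hS
  ⟨f 0, h 0⟩

theorem of_orderIso {S T : Set ℚ} (e : S ≃o ℚ) {f : ℚ → ℚ} (hf : StrictMono f)
    (h : ∀ x ∈ S, f x ∈ T) : NonScattered T :=
  ⟨fun x => f (e.symm x), fun _ _ hab => hf (e.symm.strictMono hab),
    fun x => h _ (e.symm x).2⟩

theorem of_Ioo {T : Set ℚ} {p q : ℚ} (hpq : p < q) {f : ℚ → ℚ} (hf : StrictMono f)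
    (h : ∀ x, p < x → x < q → f x ∈ T) : NonScattered T :=
  let ⟨e⟩ := nonempty_orderIso_rat_Ioo hpq
  of_orderIso e hf fun x hx => h x hx.1 hx.2

/-- The order type of `ℚ` is indivisible. -/
theorem or_of_cover {S T U : Set ℚ} (hU : NonScattered U)
    (h : ∀ x ∈ U, x ∈ S ∨ x ∈ T) : NonScattered S ∨ NonScattered T := by
  obtain ⟨f, hf, hfU⟩ := hU
  by_cases hd : ∀ p q : ℚ, p < q → ∃ x ∈ f ⁻¹' S, p < x ∧ x < q
  · obtain ⟨e⟩ := nonempty_orderIso_rat_of_meets_Ioo _ hd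
    exact Or.inl (of_orderIso e hf fun x hx => hx)
  · push Not at hd
    obtain ⟨p, q, hpq, hd⟩ := hd
    refine Or.inr (of_Ioo hpq hf fun x hp hq => ?_)
    exact (h _ (hfU x)).resolve_left fun hx => absurd hq (hd x hx hp).not_gt

theorem exists_split {S : Set ℚ} (hS : NonScattered S) :
    ∃ q, NonScattered (S ∩ Iio q) ∧ NonScattered (S ∩ Ioi q) := by
  obtain ⟨f, hf, hfS⟩ := hS
  exact ⟨f 0, of_Ioo (neg_one_lt_zero (R := ℚ)) hf fun x _ h => ⟨hfS x, hf h⟩,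
    of_Ioo (one_pos (α := ℚ)) hf fun x h _ => ⟨hfS x, hf h⟩⟩

end NonScattered

section Sequence

variable {r : ℚ → ℚ → Prop}

theorem exists_seq_meets_Ioo (h : ∀ x p q : ℚ, p < q → ∃ y, (p < y ∧ y < q) ∧ r x y) :
    ∃ a : ℕ → ℚ, (∀ n, r (a n) (a (n + 1))) ∧
      ∀ p q : ℚ, p < q → ∃ n, p < a n ∧ a n < q := by
  have : Nonempty {p : ℚ × ℚ // p.1 < p.2} := ⟨⟨(0, 1), one_pos⟩⟩
  obtain ⟨g, hg⟩ := exists_surjective_nat {p : ℚ × ℚ // p.1 < p.2}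
  choose next hnext hr using h
  refine ⟨fun n => Nat.rec 0 (fun n x => next x _ _ (g n).2) n, fun n => hr _ _ _ _, ?_⟩
  intro p q hpq
  obtain ⟨n, hn⟩ := hg ⟨(p, q), hpq⟩
  refine ⟨n + 1, ?_⟩
  have := hnext (Nat.rec 0 (fun n x => next x _ _ (g n).2) n) _ _ (g n).2
  simpa only [hn] using this

/-- A copy of `ℚ` all of whose proper `r`-initial segments are scattered contains a copy of `ℚ`
on which `r` has order type `ω`. -/
theorem exists_relIso_nat (hirr : ∀ x, ¬ r x x) (htrans : ∀ x y z, r x y → r y z → r x z)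
    {U : Set ℚ} (hU : NonScattered U) (h : ∀ x ∈ U, ¬ NonScattered {y ∈ U | ¬ r x y}) :
    ∃ A : Set ℚ, Nonempty (A ≃o ℚ) ∧
      Nonempty ((fun x y : A => r x y) ≃r ((· < ·) : ℕ → ℕ → Prop)) := by
  obtain ⟨f, hf, hfU⟩ := hU
  obtain ⟨a, ha, hmeets⟩ := exists_seq_meets_Ioo (r := fun x y => r (f x) (f y)) <| by
    intro x p q hpq
    by_contra! hcon
    exact h _ (hfU x) (NonScattered.of_Ioo hpq hf fun y hp hq => ⟨hfU y, hcon y ⟨hp, hq⟩⟩)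
  have : IsTrans ℚ r := ⟨htrans⟩
  have hmono : ∀ m n, m < n → r (f (a m)) (f (a n)) := fun m n hmn =>
    Nat.rel_of_forall_rel_succ_of_lt r (f := fun n => f (a n)) ha hmn
  have hiff : ∀ m n, r (f (a m)) (f (a n)) ↔ m < n := by
    refine fun m n => ⟨fun hr => ?_, hmono m n⟩
    by_contra hmn
    rcases (not_lt.1 hmn).eq_or_lt with rfl | hnm
    · exact hirr _ hr
    · exact hirr _ (htrans _ _ _ hr (hmono _ _ hnm))
  have hinj : Function.Injective fun n => f (a n) := by
    intro m n hmn
    by_contra hne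
    rcases lt_or_gt_of_ne hne with hlt | hlt <;> have := hmono _ _ hlt <;>
      simp only at hmn <;> rw [hmn] at this <;> exact hirr _ this
  refine ⟨range fun n => f (a n), ?_, ⟨RelIso.symm ⟨Equiv.ofInjective _ hinj, ?_⟩⟩⟩
  · obtain ⟨e⟩ := nonempty_orderIso_rat_of_meets_Ioo (range a) fun p q hpq =>
      let ⟨n, hn⟩ := hmeets p q hpq
      ⟨a n, mem_range_self n, hn⟩
    have himage : (range fun n => f (a n)) = f '' range a := range_comp f a
    rw [himage]
    exact ⟨(StrictMonoOn.orderIso f (range a) (hf.strictMonoOn _)).symm.trans e⟩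
  · exact fun {m n} => hiff m n

end Sequence

section Tree

variable {F : Type*} (L R : F → F) (p : F → ℚ)

/-- The points `p T`, where `T` is reached from `S` by applying `L` and `R` repeatedly. -/
inductive TreePoint : F → ℚ → Prop
  | root (S : F) : TreePoint S (p S)
  | left {S : F} {x : ℚ} : TreePoint (L S) x → TreePoint S x
  | right {S : F} {x : ℚ} : TreePoint (R S) x → TreePoint S x

variable {L R p}

theorem TreePoint.mem {carrier : F → Set ℚ} (hL : ∀ S, carrier (L S) ⊆ carrier S)
    (hR : ∀ S, carrier (R S) ⊆ carrier S) (hp : ∀ S, p S ∈ carrier S) {S : F} {x : ℚ}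
    (hx : TreePoint L R p S x) : x ∈ carrier S := by
  induction hx with
  | root S => exact hp S
  | left _ ih => exact hL _ ih
  | right _ ih => exact hR _ ih

theorem TreePoint.trichotomy {s : ℚ → ℚ → Prop}
    (hLp : ∀ S x, TreePoint L R p (L S) x → s x (p S))
    (hpR : ∀ S x, TreePoint L R p (R S) x → s (p S) x)
    (hLR : ∀ S x y, TreePoint L R p (L S) x → TreePoint L R p (R S) y → s x y)
    {S : F} {x y : ℚ} (hx : TreePoint L R p S x) (hy : TreePoint L R p S y) :
    x = y ∨ s x y ∨ s y x := by
  induction hx with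
  | root S =>
    cases hy with
    | root => exact Or.inl rfl
    | left hy => exact Or.inr (Or.inr (hLp _ _ hy))
    | right hy => exact Or.inr (Or.inl (hpR _ _ hy))
  | left hx ih =>
    cases hy with
    | root => exact Or.inr (Or.inl (hLp _ _ hx))
    | left hy => exact ih hy
    | right hy => exact Or.inr (Or.inl (hLR _ _ _ hx hy))
  | right hx ih =>
    cases hy with
    | root => exact Or.inr (Or.inr (hpR _ _ hx))
    | left hy => exact Or.inr (Or.inr (hLR _ _ _ hy hx))
    | right hy => exact ih hy

theorem TreePoint.exists_lt (hLp : ∀ S x, TreePoint L R p (L S) x → x < p S)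
    {S : F} {x : ℚ} (hx : TreePoint L R p S x) : ∃ y, TreePoint L R p S y ∧ y < x := by
  induction hx with
  | root S => exact ⟨_, .left (.root _), hLp _ _ (.root _)⟩
  | left _ ih => exact let ⟨y, hy, h⟩ := ih; ⟨y, .left hy, h⟩
  | right _ ih => exact let ⟨y, hy, h⟩ := ih; ⟨y, .right hy, h⟩

theorem TreePoint.exists_gt (hpR : ∀ S x, TreePoint L R p (R S) x → p S < x)
    {S : F} {x : ℚ} (hx : TreePoint L R p S x) : ∃ y, TreePoint L R p S y ∧ x < y := by
  induction hx with
  | root S => exact ⟨_, .right (.root _), hpR _ _ (.root _)⟩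
  | left _ ih => exact let ⟨y, hy, h⟩ := ih; ⟨y, .left hy, h⟩
  | right _ ih => exact let ⟨y, hy, h⟩ := ih; ⟨y, .right hy, h⟩

theorem TreePoint.exists_between (hLp : ∀ S x, TreePoint L R p (L S) x → x < p S)
    (hpR : ∀ S x, TreePoint L R p (R S) x → p S < x)
    {S : F} {x y : ℚ} (hx : TreePoint L R p S x) (hy : TreePoint L R p S y) (hxy : x < y) :
    ∃ z, TreePoint L R p S z ∧ x < z ∧ z < y := by
  induction hx with
  | root S =>
    cases hy with
    | root => exact absurd hxy (lt_irrefl _)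
    | left hy => exact absurd hxy (hLp _ _ hy).not_gt
    | right hy =>
      obtain ⟨z, hz, h⟩ := hy.exists_lt hLp
      exact ⟨z, .right hz, hpR _ _ hz, h⟩
  | left hx ih =>
    cases hy with
    | root =>
      obtain ⟨z, hz, h⟩ := hx.exists_gt hpR
      exact ⟨z, .left hz, h, hLp _ _ hz⟩
    | left hy => exact let ⟨z, hz, h⟩ := ih hy hxy; ⟨z, .left hz, h⟩
    | right hy => exact ⟨_, .root _, hLp _ _ hx, hpR _ _ hy⟩
  | right hx ih =>
    cases hy with
    | root => exact absurd hxy (hpR _ _ hx).not_gt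
    | left hy => exact absurd hxy ((hLp _ _ hy).trans (hpR _ _ hx)).not_gt
    | right hy => exact let ⟨z, hz, h⟩ := ih hy hxy; ⟨z, .right hz, h⟩

end Tree

/-- If every set of a family splits into two members of the family separated both by `<` and by
`r`, then some copy of `ℚ` has `<` contained in `r`. -/
theorem exists_orderIso_rat_of_splitting (r : ℚ → ℚ → Prop) (𝓕 : Set (Set ℚ))
    (hF : 𝓕.Nonempty) (hne : ∀ S ∈ 𝓕, S.Nonempty)
    (hsplit : ∀ S ∈ 𝓕, ∃ K₁ ∈ 𝓕, ∃ K₂ ∈ 𝓕, K₁ ⊆ S ∧ K₂ ⊆ S ∧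
      ∀ a ∈ K₁, ∀ b ∈ K₂, a < b ∧ r a b) :
    ∃ A : Set ℚ, Nonempty (A ≃o ℚ) ∧ ∀ a ∈ A, ∀ b ∈ A, a < b → r a b := by
  have hsplit' : ∀ S : 𝓕, ∃ (L R : 𝓕) (p : ℚ), (L : Set ℚ) ⊆ S ∧ (R : Set ℚ) ⊆ S ∧ p ∈ (S : Set ℚ) ∧
      (∀ a ∈ (L : Set ℚ), a < p ∧ r a p) ∧ (∀ b ∈ (R : Set ℚ), p < b ∧ r p b) ∧
      ∀ a ∈ (L : Set ℚ), ∀ b ∈ (R : Set ℚ), a < b ∧ r a b := by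
    rintro ⟨S, hS⟩
    obtain ⟨K₁, hK₁, K₂, hK₂, h₁, h₂, hK⟩ := hsplit S hS
    obtain ⟨M, hM, N, hN, h₃, h₄, hMN⟩ := hsplit K₂ hK₂
    obtain ⟨p, hp⟩ := hne M hM
    exact ⟨⟨K₁, hK₁⟩, ⟨N, hN⟩, p, h₁, h₄.trans h₂, h₂ (h₃ hp), fun a ha => hK a ha p (h₃ hp),
      fun b hb => hMN p hp b hb, fun a ha b hb => hK a ha b (h₄ hb)⟩
  choose L R p hL hR hp hLp hpR hLR using hsplit'
  obtain ⟨S, hS⟩ := hF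
  have hmem : ∀ {T : 𝓕} {x : ℚ}, TreePoint L R p T x → x ∈ (T : Set ℚ) :=
    fun hx => hx.mem (carrier := fun T : 𝓕 => (T : Set ℚ)) hL hR hp
  have hlt : ∀ T x, TreePoint L R p (L T) x → x < p T := fun T x hx => (hLp T x (hmem hx)).1
  have hgt : ∀ T x, TreePoint L R p (R T) x → p T < x := fun T x hx => (hpR T x (hmem hx)).1
  refine ⟨{x | TreePoint L R p ⟨S, hS⟩ x}, nonempty_orderIso_rat _ ⟨_, .root _⟩
    (fun x hx => hx.exists_lt hlt) (fun x hx => hx.exists_gt hgt)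
    (fun x hx y hy => hx.exists_between hlt hgt hy), fun a ha b hb hab => ?_⟩
  rcases ha.trichotomy (s := fun a b => a < b ∧ r a b) (fun T x hx => hLp T x (hmem hx))
    (fun T x hx => hpR T x (hmem hx))
    (fun T x y hx hy => hLR T x (hmem hx) y (hmem hy)) hb with h | h | h
  · exact absurd hab h.not_lt
  · exact h.2
  · exact absurd hab h.1.not_gt

theorem exists_mem_both_segments_nonScattered {r : ℚ → ℚ → Prop} {X : Set ℚ}
    (hX : NonScattered X)
    (h₁ : ∀ U, NonScattered U → ∃ x ∈ U, NonScattered {y ∈ U | ¬ r x y})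
    (h₂ : ∀ U, NonScattered U → ∃ x ∈ U, NonScattered {y ∈ U | ¬ r y x}) :
    ∃ x ∈ X, NonScattered {y ∈ X | ¬ r x y} ∧ NonScattered {y ∈ X | ¬ r y x} := by
  by_contra! hcon
  have hmono : ∀ {S T : Set ℚ}, S ⊆ T → NonScattered S → NonScattered T :=
    fun hST ⟨f, hf, hfS⟩ => ⟨f, hf, fun x => hST (hfS x)⟩
  rcases hX.or_of_cover (S := {x ∈ X | ¬ NonScattered {y ∈ X | ¬ r x y}})
    (T := {x ∈ X | ¬ NonScattered {y ∈ X | ¬ r y x}}) (fun x hx => by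
      by_cases h : NonScattered {y ∈ X | ¬ r x y}
      · exact Or.inr ⟨hx, hcon x hx h⟩
      · exact Or.inl ⟨hx, h⟩) with hU | hU
  · obtain ⟨x, hx, h⟩ := h₁ _ hU
    exact hx.2 (hmono (fun y hy => ⟨hy.1.1, hy.2⟩) h)
  · obtain ⟨x, hx, h⟩ := h₂ _ hU
    exact hx.2 (hmono (fun y hy => ⟨hy.1.1, hy.2⟩) h)

theorem NonScattered.exists_separated {r : ℚ → ℚ → Prop}
    (htrans : ∀ x y z, r x y → r y z → r x z) (htri : ∀ x y, r x y ∨ x = y ∨ r y x)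
    {X : Set ℚ} {x : ℚ} (h₁ : NonScattered {y ∈ X | ¬ r x y})
    (h₂ : NonScattered {y ∈ X | ¬ r y x}) :
    ∃ K₁ K₂, NonScattered K₁ ∧ NonScattered K₂ ∧ K₁ ⊆ X ∧ K₂ ⊆ X ∧
      ((∀ a ∈ K₁, ∀ b ∈ K₂, a < b ∧ r a b) ∨ (∀ a ∈ K₁, ∀ b ∈ K₂, a < b ∧ r b a)) := by
  have hr : ∀ a b, ¬ r x a → ¬ r b x → a ≠ b → r a b := by
    intro a b ha hb hab
    rcases htri x a with h | rfl | h
    · exact absurd h ha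
    · exact ((htri b x).resolve_left hb).resolve_left hab.symm
    · rcases htri b x with h' | rfl | h'
      · exact absurd h' hb
      · exact h
      · exact htrans _ _ _ h h'
  obtain ⟨q, hl, hu⟩ := h₁.exists_split
  rcases h₂.or_of_cover (S := {y ∈ X | ¬ r y x} ∩ Iic q) (T := {y ∈ X | ¬ r y x} ∩ Ici q)
    (fun y hy => (le_total y q).imp (fun h => ⟨hy, h⟩) fun h => ⟨hy, h⟩) with h | h
  · refine ⟨_, _, h, hu, fun y hy => hy.1.1, fun y hy => hy.1.1, Or.inr fun a ha b hb => ?_⟩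
    have hab : a < b := lt_of_le_of_lt ha.2 hb.2
    exact ⟨hab, hr b a hb.1.2 ha.1.2 hab.ne'⟩
  · refine ⟨_, _, hl, h, fun y hy => hy.1.1, fun y hy => hy.1.1, Or.inl fun a ha b hb => ?_⟩
    have hab : a < b := lt_of_lt_of_le ha.2 hb.2
    exact ⟨hab, hr a b ha.1.2 hb.1.2 hab.ne⟩

theorem exists_canonical_subset (r : ℚ → ℚ → Prop) (hirr : ∀ x, ¬ r x x)
    (htrans : ∀ x y z, r x y → r y z → r x z) (htri : ∀ x y, r x y ∨ x = y ∨ r y x) :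
    ∃ A : Set ℚ, Nonempty (A ≃o ℚ) ∧
      (Nonempty ((fun x y : A => r x y) ≃r ((· < ·) : ℕ → ℕ → Prop)) ∨
       Nonempty ((fun x y : A => r y x) ≃r ((· < ·) : ℕ → ℕ → Prop)) ∨
       (∀ a ∈ A, ∀ b ∈ A, a < b → r a b) ∨
       (∀ a ∈ A, ∀ b ∈ A, a < b → r b a)) := by
  by_cases h₁ : ∀ U, NonScattered U → ∃ x ∈ U, NonScattered {y ∈ U | ¬ r x y}
  swap
  · push Not at h₁
    obtain ⟨U, hU, h⟩ := h₁
    obtain ⟨A, hA, e⟩ := exists_relIso_nat hirr htrans hU h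
    exact ⟨A, hA, Or.inl e⟩
  by_cases h₂ : ∀ U, NonScattered U → ∃ x ∈ U, NonScattered {y ∈ U | ¬ r y x}
  swap
  · push Not at h₂
    obtain ⟨U, hU, h⟩ := h₂
    obtain ⟨A, hA, e⟩ := exists_relIso_nat (r := fun x y => r y x) hirr
      (fun x y z hxy hyz => htrans z y x hyz hxy) hU h
    exact ⟨A, hA, Or.inr (Or.inl e)⟩
  by_cases h₃ : ∀ X, NonScattered X → ∃ K₁, NonScattered K₁ ∧ ∃ K₂, NonScattered K₂ ∧
      K₁ ⊆ X ∧ K₂ ⊆ X ∧ ∀ a ∈ K₁, ∀ b ∈ K₂, a < b ∧ r b a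
  · obtain ⟨A, hA, h⟩ := exists_orderIso_rat_of_splitting (fun x y => r y x) {S | NonScattered S}
      ⟨_, NonScattered.univ⟩ (fun S hS => hS.nonempty) h₃
    exact ⟨A, hA, Or.inr (Or.inr (Or.inr h))⟩
  · obtain ⟨X, hX⟩ := not_forall.1 h₃
    obtain ⟨hX, hno⟩ := Classical.not_imp.1 hX
    obtain ⟨A, hA, h⟩ := exists_orderIso_rat_of_splitting r {S | NonScattered S ∧ S ⊆ X}
      ⟨X, hX, Subset.rfl⟩ (fun S hS => hS.1.nonempty) <| by
        rintro S ⟨hS, hSX⟩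
        obtain ⟨x, -, hl, hu⟩ := exists_mem_both_segments_nonScattered hS h₁ h₂
        obtain ⟨K₁, K₂, hK₁, hK₂, hK₁S, hK₂S, h | h⟩ :=
          NonScattered.exists_separated htrans htri hl hu
        · exact ⟨K₁, ⟨hK₁, hK₁S.trans hSX⟩, K₂, ⟨hK₂, hK₂S.trans hSX⟩, hK₁S, hK₂S, h⟩
        · exact absurd ⟨K₁, hK₁, K₂, hK₂, hK₁S.trans hSX, hK₂S.trans hSX, h⟩ hno
    exact ⟨A, hA, Or.inr (Or.inr (Or.inl h))⟩


/-- Lemma 3.6 (canonisation on ℚ): for any second linear order `lo` (written ≺) on ℚ,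
there is a subset `A ⊆ ℚ` order-isomorphic to ℚ under the usual order `<` such that
either (A, ≺) ≅ ℕ, or (A, ≺) ≅ ℕᵒᵈ, or ≺ agrees with `<` on `A`, or ≺ is the reverse
of `<` on `A`. -/
theorem stmt_3 (lo : LinearOrder ℚ) :
    ∃ A : Set ℚ, Nonempty (A ≃o ℚ) ∧
      (Nonempty ((fun x y : A => lo.lt x y) ≃r ((· < ·) : ℕ → ℕ → Prop)) ∨
       Nonempty ((fun x y : A => lo.lt x y) ≃r ((· < ·) : ℕᵒᵈ → ℕᵒᵈ → Prop)) ∨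
       (∀ a ∈ A, ∀ b ∈ A, (lo.lt a b ↔ a < b)) ∨
       (∀ a ∈ A, ∀ b ∈ A, (lo.lt a b ↔ b < a))) := by
  have htri : ∀ x y, lo.lt x y ∨ x = y ∨ lo.lt y x := fun x y => @lt_trichotomy ℚ lo x y
  have hirr : ∀ x, ¬ lo.lt x x := fun x => @lt_irrefl ℚ lo.toPreorder x
  have htrans : ∀ x y z, lo.lt x y → lo.lt y z → lo.lt x z :=
    fun x y z => @lt_trans ℚ lo.toPreorder x y z
  have hasymm : ∀ x y, lo.lt x y → ¬ lo.lt y x := fun x y h h' => hirr x (htrans x y x h h')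
  obtain ⟨A, hA, ⟨⟨e⟩⟩ | ⟨⟨e⟩⟩ | h | h⟩ := exists_canonical_subset lo.lt hirr htrans htri
  · exact ⟨A, hA, Or.inl ⟨e⟩⟩
  · exact ⟨A, hA, Or.inr (Or.inl ⟨⟨e.toEquiv.trans OrderDual.toDual,
      fun {a b} => e.map_rel_iff (a := b) (b := a)⟩⟩)⟩
  · refine ⟨A, hA, Or.inr (Or.inr (Or.inl fun a ha b hb => ⟨fun hab => ?_, h a ha b hb⟩))⟩
    rcases @lt_trichotomy ℚ Rat.linearOrder a b with hlt | rfl | hlt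
    · exact hlt
    · exact absurd hab (hirr a)
    · exact absurd hab (hasymm _ _ (h b hb a ha hlt))
  · refine ⟨A, hA, Or.inr (Or.inr (Or.inr fun a ha b hb => ⟨fun hab => ?_, h b hb a ha⟩))⟩
    rcases @lt_trichotomy ℚ Rat.linearOrder a b with hlt | rfl | hlt
    · exact absurd hab (hasymm _ _ (h a ha b hb hlt))
    · exact absurd hab (hirr a)
    · exact hlt
end

section
/- Let ≺ be a linear order on ℚ such that every proper subset I ⊊ ℚ that is downward closed with respect to ≺ is scattered with respect to the usual order < (i.e. has no subset order-isomorphic to ℚ under <). Then there exists A ⊆ ℚ with (A, <) order-isomorphic to ℚ and (A, ≺) order-isomorphic to ℕ. -/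
/-- A set of rationals meeting every open interval is order-isomorphic to `ℚ`. -/
theorem nonempty_orderIso_rat_of_forall_exists_mem_Ioo {A : Set ℚ}
    (hA : ∀ a b : ℚ, a < b → ∃ x ∈ A, x ∈ Set.Ioo a b) : Nonempty (A ≃o ℚ) := by
  have : Nonempty A := by
    obtain ⟨x, hx, -⟩ := hA 0 1 one_pos
    exact ⟨⟨x, hx⟩⟩
  have : DenselyOrdered A := ⟨fun a b hab => by
    obtain ⟨x, hx, hax, hxb⟩ := hA a b hab
    exact ⟨⟨x, hx⟩, hax, hxb⟩⟩
  have : NoMinOrder A := ⟨fun a => by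
    obtain ⟨x, hx, -, hxa⟩ := hA (a - 1) a (sub_one_lt _)
    exact ⟨⟨x, hx⟩, hxa⟩⟩
  have : NoMaxOrder A := ⟨fun a => by
    obtain ⟨x, hx, hax, -⟩ := hA a (a + 1) (lt_add_one _)
    exact ⟨⟨x, hx⟩, hax⟩⟩
  exact Order.iso_of_countable_dense A ℚ

theorem nonempty_Ioo_orderIso_rat {a b : ℚ} (hab : a < b) : Nonempty (Set.Ioo a b ≃o ℚ) := by
  have : Nonempty (Set.Ioo a b) := (Set.nonempty_Ioo.2 hab).to_subtype
  exact Order.iso_of_countable_dense (Set.Ioo a b) ℚ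

/-- If the `r`-successors of each point are dense in `ℚ`, then some copy of `ℚ` inside `ℚ` has
order type `ℕ` with respect to `r`. -/
theorem exists_orderIso_rat_and_relIso_nat (r : ℚ → ℚ → Prop) [IsTrans ℚ r] [Std.Irrefl r]
    (hr : ∀ x a b : ℚ, a < b → ∃ y ∈ Set.Ioo a b, r x y) :
    ∃ A : Set ℚ, Nonempty (A ≃o ℚ) ∧
      Nonempty ((fun x y : A => r x y) ≃r ((· < ·) : ℕ → ℕ → Prop)) := by
  have : Nonempty {p : ℚ × ℚ // p.1 < p.2} := ⟨⟨(0, 1), one_pos⟩⟩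
  obtain ⟨e, he⟩ := exists_surjective_nat {p : ℚ × ℚ // p.1 < p.2}
  choose f hf hrf using fun (x : ℚ) (p : {p : ℚ × ℚ // p.1 < p.2}) => hr x p.1.1 p.1.2 p.2
  let u : ℕ → ℚ := fun n => Nat.rec 0 (fun k x => f x (e k)) n
  have hu : ∀ {m n : ℕ}, m < n → r (u m) (u n) := fun h =>
    Nat.rel_of_forall_rel_succ_of_lt r (fun n => hrf (u n) (e n)) h
  let g : ((· < ·) : ℕ → ℕ → Prop) ↪r r := RelEmbedding.ofMonotone u fun _ _ => hu
  refine ⟨Set.range u, nonempty_orderIso_rat_of_forall_exists_mem_Ioo fun a b hab => ?_,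
    ⟨RelIso.symm ⟨Equiv.ofInjective u g.injective, g.map_rel_iff⟩⟩⟩
  obtain ⟨n, hn⟩ := he ⟨(a, b), hab⟩
  have hmem := hf (u n) (e n)
  rw [hn] at hmem
  exact ⟨_, ⟨n + 1, by simp only [u, hn]⟩, hmem⟩

/-- Claim 3.6.1: if `lo` (written ≺) is a linear order on ℚ such that every proper
≺-downward-closed subset of ℚ is scattered with respect to the usual order, then
there is `A ⊆ ℚ` with (A, <) ≅ ℚ and (A, ≺) ≅ ℕ. -/
theorem stmt_4 (lo : LinearOrder ℚ)
    (hscat : ∀ I : Set ℚ, I ≠ Set.univ → (∀ x ∈ I, ∀ y : ℚ, lo.lt y x → y ∈ I) →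
      ∀ B : Set ℚ, B ⊆ I → ¬ Nonempty (B ≃o ℚ)) :
    ∃ A : Set ℚ, Nonempty (A ≃o ℚ) ∧
      Nonempty ((fun x y : A => lo.lt x y) ≃r ((· < ·) : ℕ → ℕ → Prop)) := by
  have : IsTrans ℚ lo.lt := ⟨fun _ _ _ => @lt_trans ℚ lo.toPreorder _ _ _⟩
  have : Std.Irrefl lo.lt := ⟨fun _ => @lt_irrefl ℚ lo.toPreorder _⟩
  refine exists_orderIso_rat_and_relIso_nat lo.lt fun x a b hab => ?_
  obtain ⟨c, hac, hcb, hxc⟩ : ∃ c, a < c ∧ c ≤ b ∧ x ∉ Set.Ioo a c := by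
    by_cases hx : x ∈ Set.Ioo a b
    · exact ⟨x, hx.1, hx.2.le, fun h => h.2.false⟩
    · exact ⟨b, hab, le_rfl, hx⟩
  by_contra hne
  refine hscat {y | lo.lt y x} (fun h => ?_) (fun y hy z hz => trans_of lo.lt hz hy)
    (Set.Ioo a c) (fun y hy => ?_) (nonempty_Ioo_orderIso_rat hac)
  · exact irrefl_of lo.lt x (h.symm ▸ Set.mem_univ x : x ∈ {y | lo.lt y x})
  · rcases @lt_trichotomy ℚ lo y x with h | rfl | h
    · exact h
    · exact absurd hy hxc
    · exact absurd ⟨y, ⟨hy.1, hy.2.trans_le hcb⟩, h⟩ hne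
end

section
/- Let T be a countable non-scattered linear order (i.e. containing a subset order-isomorphic to ℚ), and let L be a linear order such that there exist a well-ordered type α and an injection from L into the powerset of α (Set α), and such that there is at least one copy of T in L. Then L ↛ (T)^T: there exists a function F from the copies of T in L to Bool with no homogeneous copy. -/
/-- A countable linear order embeds into every linear order containing a copy of `ℚ`. -/
theorem nonempty_orderEmbedding_of_orderIso_rat {D T : Type*} [LinearOrder D] [Countable D]
    [LinearOrder T] (hns : ∃ s : Set T, Nonempty (s ≃o ℚ)) : Nonempty (D ↪o T) := by
  obtain ⟨s, ⟨e⟩⟩ := hns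
  obtain ⟨f⟩ := Order.embedding_from_countable_to_dense D ℚ
  exact ⟨(f.trans e.symm.toOrderEmbedding).trans (OrderEmbedding.subtype (· ∈ s))⟩

/-- A countable non-scattered linear order has a self-embedding that is not surjective. -/
theorem exists_orderEmbedding_not_surjective {T : Type*} [LinearOrder T] [Countable T]
    (hns : ∃ s : Set T, Nonempty (s ≃o ℚ)) : ∃ k : T ↪o T, ∃ t, t ∉ Set.range k := by
  obtain ⟨g⟩ := nonempty_orderEmbedding_of_orderIso_rat (D := WithTop T) hns
  refine ⟨WithTop.coeOrderHom.trans g, g ⊤, ?_⟩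
  rintro ⟨u, hu⟩
  exact WithTop.coe_ne_top (g.injective hu)

open Filter in
/-- The direct limit of `T → T → ⋯` along a non-surjective self-embedding is realised inside an
ultrapower of `T`; being countable, it embeds into `T`. -/
theorem exists_orderEmbedding_chain {T : Type*} [LinearOrder T] [Countable T]
    (hns : ∃ s : Set T, Nonempty (s ≃o ℚ)) :
    ∃ h : ℕ → T ↪o T, ∀ n, Set.range (h n) ⊂ Set.range (h (n + 1)) := by
  obtain ⟨k, t, ht⟩ := exists_orderEmbedding_not_surjective hns
  let φ : ℕ → T → Germ (hyperfilter ℕ : Filter ℕ) T := fun n u => ↑(fun m => k^[m - n] u)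
  have hmono (n : ℕ) : StrictMono (φ n) := fun u v huv =>
    Germ.coe_lt.2 (Eventually.of_forall fun m => k.strictMono.iterate (m - n) huv)
  have hstep (n : ℕ) (u : T) : φ (n + 1) (k u) = φ n u := by
    refine Germ.coe_eq.2 (Nat.hyperfilter_le_atTop ?_)
    filter_upwards [eventually_gt_atTop n] with m hm
    rw [← Function.iterate_succ_apply]
    congr 2
    omega
  let D : Set (Germ (hyperfilter ℕ : Filter ℕ) T) := ⋃ n, Set.range (φ n)
  have : Countable D := (Set.countable_iUnion fun n => Set.countable_range (φ n)).to_subtype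
  obtain ⟨g⟩ := nonempty_orderEmbedding_of_orderIso_rat (D := D) hns
  let ψ (n : ℕ) : T ↪o D := OrderEmbedding.ofStrictMono
    (fun u => ⟨φ n u, Set.mem_iUnion.2 ⟨n, u, rfl⟩⟩) fun _ _ huv => hmono n huv
  have hψ (n : ℕ) (u : T) : ψ (n + 1) (k u) = ψ n u := Subtype.ext (hstep n u)
  refine ⟨fun n => (ψ n).trans g, fun n => ⟨?_, fun hsub => ?_⟩⟩
  · rintro _ ⟨u, rfl⟩
    exact ⟨k u, congrArg g (hψ n u)⟩
  · obtain ⟨u, hu⟩ := hsub ⟨t, rfl⟩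
    refine ht ⟨u, (ψ (n + 1)).injective ?_⟩
    rw [hψ]
    exact g.injective hu


/-- Theorem 3.5: if `T` is a countable non-scattered linear order and the underlying set
of the linear order `L` injects into the powerset of a well-ordered type `α`, then
`L ↛ (T)^T`: there is a colouring of the copies of `T` in `L` (subsets of `L`
order-isomorphic to `T`) with no homogeneous copy. -/
theorem stmt_7 {T L α : Type*} [LinearOrder T] [Countable T] [LinearOrder L]
    [LinearOrder α] [WellFoundedLT α]
    (hns : ∃ s : Set T, Nonempty (s ≃o ℚ))
    (i : L ↪ Set α)
    (hcopy : ∃ A : Set L, Nonempty (A ≃o T)) :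
    ∃ F : {A : Set L // Nonempty (A ≃o T)} → Bool,
      ∀ H : {A : Set L // Nonempty (A ≃o T)},
        ¬ ∀ Y Z : {A : Set L // Nonempty (A ≃o T)},
          (Y : Set L) ⊆ (H : Set L) → (Z : Set L) ⊆ (H : Set L) → F Y = F Z := by
  classical
  let P := {A : Set L // Nonempty (A ≃o T)}
  have wf : WellFounded (WellOrderingRel : P → P → Prop) := IsWellFounded.wf
  refine ⟨fun X => decide (∃ Y : P, (Y : Set L) ⊆ X ∧ WellOrderingRel Y X), fun H hH => ?_⟩
  have hfalse (X Y : P) (hX : (X : Set L) ⊆ H) (hYX : (Y : Set L) ⊆ X) :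
      ¬ WellOrderingRel Y X := by
    intro hlt
    obtain ⟨M, hM, hmin⟩ := wf.has_min {Z : P | (Z : Set L) ⊆ H} ⟨H, Set.Subset.refl (H : Set L)⟩
    obtain ⟨Z, hZM, hZ⟩ := (decide_eq_decide.1 (hH X M hX hM)).1 ⟨Y, hYX, hlt⟩
    exact hmin Z (hZM.trans hM) hZ
  obtain ⟨h, hh⟩ := exists_orderEmbedding_chain hns
  obtain ⟨e⟩ := H.2
  let ι : T ↪o L := e.symm.toOrderEmbedding.trans (OrderEmbedding.subtype (· ∈ (H : Set L)))
  have hι (u : T) : ι u ∈ (H : Set L) := (e.symm u).2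
  let X (n : ℕ) : P := ⟨Set.range ((h n).trans ι), ⟨(OrderEmbedding.orderIso (f := (h n).trans ι)).symm⟩⟩
  have hXH (n : ℕ) : (X n : Set L) ⊆ H := by
    rintro _ ⟨u, rfl⟩
    exact hι _
  have hX (n : ℕ) : (X n : Set L) ⊂ X (n + 1) := by
    have hr (m : ℕ) : (X m : Set L) = ι '' Set.range (h m) := Set.range_comp ι (h m)
    rw [hr, hr]
    exact ι.injective.image_strictMono (hh n)
  obtain ⟨_, ⟨n, rfl⟩, hmin⟩ := wf.has_min (Set.range X) ⟨X 0, 0, rfl⟩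
  rcases trichotomous_of WellOrderingRel (X n) (X (n + 1)) with hlt | heq | hgt
  · exact hfalse _ _ (hXH (n + 1)) (hX n).subset hlt
  · exact (hX n).ne (congrArg Subtype.val heq)
  · exact hmin _ ⟨n + 1, rfl⟩ hgt
end

section
/- Let T be a scattered linear order that contains a subset order-isomorphic to ℕᵒᵈ ×ₗ ℕ (the lexicographic product, i.e. the order type ωω* consisting of ω*-many consecutive copies of ω) or a subset order-isomorphic to ℕ ×ₗ ℕᵒᵈ (the order type ω*ω). Let L be a linear order such that there exist a well-ordered type α and an injection from L into the powerset of α (Set α), and such that there is at least one copy of T in L. Then L ↛ (T)^T: there exists a function F from the copies of T in L to Bool with no homogeneous copy. -/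
/-- A map that sends every element to a strictly smaller one has acyclic orbits, so its functional
graph is 2-colorable. -/
theorem exists_bool_coloring_of_map_lt {X : Type*} [Preorder X] (f : X → X)
    (hf : ∀ x, f x < x) : ∃ F : X → Bool, ∀ x, F (f x) ≠ F x := by
  have hinj (x : X) : Function.Injective fun n => f^[n] x := by
    refine (strictAnti_nat_of_succ_lt fun n => ?_).injective
    rw [Function.iterate_succ_apply']
    exact hf _
  let S : Setoid X :=
    { r := fun x y => ∃ m n, f^[m] x = f^[n] y
      iseqv :=
        { refl := fun x => ⟨0, 0, rfl⟩
          symm := fun ⟨m, n, h⟩ => ⟨n, m, h.symm⟩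
          trans := by
            rintro x y z ⟨m, n, h⟩ ⟨k, l, h'⟩
            refine ⟨k + m, n + l, ?_⟩
            rw [Function.iterate_add_apply, h, ← Function.iterate_add_apply, Nat.add_comm k n,
              Function.iterate_add_apply, h', ← Function.iterate_add_apply] } }
  have hrep (x : X) : ∃ m n, f^[m] x = f^[n] (Quotient.mk S x).out :=
    S.symm (Quotient.mk_out x)
  have hmk (x : X) : Quotient.mk S (f x) = Quotient.mk S x := Quotient.sound ⟨0, 1, rfl⟩
  choose m n h using hrep
  refine ⟨fun x => decide (Even (m x + n x)), fun x => ?_⟩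
  have h₁ := h (f x)
  rw [hmk, ← Function.iterate_succ_apply] at h₁
  have h₂ : n x + (m (f x) + 1) = n (f x) + m x := by
    apply hinj x
    change f^[_] x = f^[_] x
    rw [Function.iterate_add_apply, h₁, Function.iterate_add_apply, h x,
      ← Function.iterate_add_apply, ← Function.iterate_add_apply, Nat.add_comm]
  intro heq
  have heven : Even (m (f x) + n (f x)) ↔ Even (m x + n x) := by simpa using heq
  grind

/-- Shifting an infinite chain of covers by one step is a non-surjective self-embedding. -/
theorem exists_strictMono_not_surjective_of_covBy {T : Type*} [LinearOrder T] (a : ℕ → T)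
    (ha : ∀ n, a n ⋖ a (n + 1)) : ∃ f : T → T, StrictMono f ∧ ¬ Function.Surjective f := by
  classical
  have hmono : StrictMono a := strictMono_nat_of_lt_succ fun n => (ha n).lt
  let f : T → T := fun x => if h : ∃ n, x = a n then a (h.choose + 1) else x
  have hfa (n : ℕ) : f (a n) = a (n + 1) := by
    have h : ∃ k, a n = a k := ⟨n, rfl⟩
    simp only [f, dif_pos h]
    rw [← hmono.injective h.choose_spec]
  have hf {x : T} (h : ¬ ∃ n, x = a n) : f x = x := dif_neg h
  refine ⟨f, fun x y hxy => ?_, fun hsurj => ?_⟩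
  · by_cases hx : ∃ n, x = a n <;> by_cases hy : ∃ n, y = a n
    · obtain ⟨k, rfl⟩ := hx
      obtain ⟨l, rfl⟩ := hy
      rw [hfa, hfa]
      exact hmono (Nat.succ_lt_succ (hmono.lt_iff_lt.1 hxy))
    · obtain ⟨k, rfl⟩ := hx
      rw [hfa, hf hy]
      exact ((ha k).ge_of_gt hxy).lt_of_ne fun h => hy ⟨_, h.symm⟩
    · obtain ⟨l, rfl⟩ := hy
      rw [hfa, hf hx]
      exact hxy.trans (ha l).lt
    · rwa [hf hx, hf hy]
  · obtain ⟨x, hx⟩ := hsurj (a 0)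
    by_cases h : ∃ n, x = a n
    · obtain ⟨k, rfl⟩ := h
      rw [hfa] at hx
      exact absurd (hmono.injective hx) (Nat.succ_ne_zero k)
    · exact h ⟨0, (hf h).symm.trans hx⟩

/-- If no element starts an infinite ascending or descending chain of covers, an infinite linear
order contains the rationals. -/
theorem nonempty_rat_orderEmbedding_of_wellFounded_covBy {T : Type*} [LinearOrder T] [Infinite T]
    (hdown : WellFounded fun x y : T => x ⋖ y) (hup : WellFounded fun x y : T => y ⋖ x) :
    Nonempty (ℚ ↪o T) := by
  let D : Set T := {x | ∀ y, ¬ x ⋖ y}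
  have climb (w : T) : ∃ t ∈ D, w ≤ t := by
    induction w using hup.induction with
    | _ w ih =>
      by_cases hw : w ∈ D
      · exact ⟨w, hw, le_rfl⟩
      · obtain ⟨v, hv⟩ : ∃ v, w ⋖ v := by simpa [D] using hw
        obtain ⟨t, ht, hvt⟩ := ih v hv
        exact ⟨t, ht, hv.le.trans hvt⟩
  have climb_lt {y : T} (hy : ∀ z, ¬ z ⋖ y) (w : T) : w < y → ∃ t ∈ D, w ≤ t ∧ t < y := by
    induction w using hup.induction with
    | _ w ih =>
      intro hwy
      by_cases hw : w ∈ D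
      · exact ⟨w, hw, le_rfl, hwy⟩
      · obtain ⟨v, hv⟩ : ∃ v, w ⋖ v := by simpa [D] using hw
        obtain ⟨t, ht, hvt, hty⟩ := ih v hv
          ((hv.ge_of_gt hwy).lt_of_ne fun h => hy w (h ▸ hv))
        exact ⟨t, ht, hv.le.trans hvt, hty⟩
  have dense {x : T} (hx : x ∈ D) (y : T) : x < y → ∃ t ∈ D, x < t ∧ t < y := by
    induction y using hdown.induction with
    | _ y ih =>
      intro hxy
      by_cases hy : ∃ z, z ⋖ y
      · obtain ⟨z, hz⟩ := hy
        obtain ⟨t, ht, hxt, htz⟩ := ih z hz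
          ((hz.le_of_lt hxy).lt_of_ne fun h => hx y (h ▸ hz))
        exact ⟨t, ht, hxt, htz.trans hz.lt⟩
      · obtain ⟨w, hxw, hwy⟩ := (not_covBy_iff hxy).1 (hx y)
        obtain ⟨t, ht, hwt, hty⟩ := climb_lt (not_exists.1 hy) w hwy
        exact ⟨t, ht, hxw.trans_le hwt, hty⟩
  have below (y : T) : (Set.Iic y).Finite ∨ ∃ x ∈ D, x < y := by
    induction y using hdown.induction with
    | _ y ih =>
      by_cases hy : ∃ z, z ⋖ y
      · obtain ⟨z, hz⟩ := hy
        rcases ih z hz with h | ⟨x, hx, hxz⟩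
        · refine .inl ((h.insert y).subset fun u hu => ?_)
          rcases (Set.mem_Iic.1 hu).eq_or_lt with rfl | hu
          · exact Set.mem_insert _ _
          · exact Set.mem_insert_of_mem _ (hz.le_of_lt hu)
        · exact .inr ⟨x, hx, hxz.trans hz.lt⟩
      · by_cases hw : ∃ w, w < y
        · obtain ⟨w, hw⟩ := hw
          obtain ⟨t, ht, -, hty⟩ := climb_lt (not_exists.1 hy) w hw
          exact .inr ⟨t, ht, hty⟩
        · refine .inl ((Set.finite_singleton y).subset fun u hu => ?_)
          exact (Set.mem_Iic.1 hu).eq_or_lt.resolve_right fun h => hw ⟨u, h⟩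
  obtain ⟨x, hx, y, hxy⟩ : ∃ x ∈ D, ∃ y, x < y := by
    obtain ⟨t, ht, -⟩ := climb (Classical.arbitrary T)
    by_cases hmax : ∃ y, t < y
    · exact ⟨t, ht, hmax⟩
    · rcases below t with h | ⟨x, hx, hxt⟩
      · exact absurd (h.subset fun u _ => not_lt.1 fun hu => hmax ⟨u, hu⟩) Set.infinite_univ
      · exact ⟨x, hx, t, hxt⟩
  obtain ⟨t, ht, hxt, -⟩ := dense hx y hxy
  have : Nontrivial D := ⟨⟨x, hx⟩, ⟨t, ht⟩, fun h => hxt.ne (congrArg Subtype.val h)⟩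
  have : DenselyOrdered D := ⟨fun u v huv =>
    let ⟨t, ht, hut, htv⟩ := dense u.2 v.1 huv
    ⟨⟨t, ht⟩, hut, htv⟩⟩
  obtain ⟨g⟩ := Order.embedding_from_countable_to_dense ℚ D
  exact ⟨g.trans (OrderEmbedding.subtype _)⟩

theorem exists_strictMono_not_surjective_of_scattered {T : Type*} [LinearOrder T] [Infinite T]
    (hscat : IsEmpty (ℚ ↪o T)) : ∃ f : T → T, StrictMono f ∧ ¬ Function.Surjective f := by
  by_cases hdown : WellFounded fun x y : T => x ⋖ y
  · by_cases hup : WellFounded fun x y : T => y ⋖ x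
    · exact (not_nonempty_iff.2 hscat
        (nonempty_rat_orderEmbedding_of_wellFounded_covBy hdown hup)).elim
    · rw [wellFounded_iff_isEmpty_descending_chain, not_isEmpty_iff] at hup
      obtain ⟨a, ha⟩ := hup
      exact exists_strictMono_not_surjective_of_covBy a ha
  · rw [wellFounded_iff_isEmpty_descending_chain, not_isEmpty_iff] at hdown
    obtain ⟨a, ha⟩ := hdown
    obtain ⟨f, hf, hsurj⟩ := exists_strictMono_not_surjective_of_covBy (T := Tᵒᵈ)
      (fun n => OrderDual.toDual (a n)) fun n => (ha n).toDual
    exact ⟨fun x => OrderDual.ofDual (f (OrderDual.toDual x)), fun x y hxy => hf hxy, hsurj⟩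

/-- Theorem 3.7: if `T` is a scattered linear order containing a copy of ωω*
(`ℕᵒᵈ ×ₗ ℕ`) or of ω*ω (`ℕ ×ₗ ℕᵒᵈ`), and the underlying set of the linear order `L`
injects into the powerset of a well-ordered type `α`, then `L ↛ (T)^T`. -/
theorem stmt_9 {T L α : Type*} [LinearOrder T] [LinearOrder L]
    [LinearOrder α] [WellFoundedLT α]
    (hscat : ∀ s : Set T, ¬ Nonempty (s ≃o ℚ))
    (hemb : (∃ s : Set T, Nonempty (s ≃o (ℕᵒᵈ ×ₗ ℕ))) ∨
            (∃ s : Set T, Nonempty (s ≃o (ℕ ×ₗ ℕᵒᵈ))))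
    (i : L ↪ Set α)
    (hcopy : ∃ A : Set L, Nonempty (A ≃o T)) :
    ∃ F : {A : Set L // Nonempty (A ≃o T)} → Bool,
      ∀ H : {A : Set L // Nonempty (A ≃o T)},
        ¬ ∀ Y Z : {A : Set L // Nonempty (A ≃o T)},
          (Y : Set L) ⊆ (H : Set L) → (Z : Set L) ⊆ (H : Set L) → F Y = F Z := by
  have : Infinite T := by
    rcases hemb with ⟨s, ⟨e⟩⟩ | ⟨s, ⟨e⟩⟩
    · refine Infinite.of_injective (fun n : ℕ => (e.symm (toLex (OrderDual.toDual n, 0)) : T)) ?_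
      exact Subtype.val_injective.comp (e.symm.injective.comp fun m n h =>
        congrArg (fun p : ℕᵒᵈ ×ₗ ℕ => OrderDual.ofDual (ofLex p).1) h)
    · refine Infinite.of_injective (fun n : ℕ => (e.symm (toLex (n, OrderDual.toDual 0)) : T)) ?_
      exact Subtype.val_injective.comp (e.symm.injective.comp fun m n h =>
        congrArg (fun p : ℕ ×ₗ ℕᵒᵈ => (ofLex p).1) h)
  obtain ⟨f, hf, hsurj⟩ := exists_strictMono_not_surjective_of_scattered (T := T)
    ⟨fun g => hscat (Set.range g) ⟨g.orderIso.symm⟩⟩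
  have hsub (H : {A : Set L // Nonempty (A ≃o T)}) :
      ∃ K : {A : Set L // Nonempty (A ≃o T)}, K < H := by
    obtain ⟨H, ⟨e⟩⟩ := H
    have hmono : StrictMono fun t => (e.symm (f t) : L) := fun x y hxy =>
      e.symm.strictMono (hf hxy)
    refine ⟨⟨Set.range fun t => (e.symm (f t) : L), ⟨(hmono.orderIso _).symm⟩⟩, ?_⟩
    refine Set.ssubset_iff_subset_ne.2
      ⟨Set.range_subset_iff.2 fun t => (e.symm (f t)).2, fun h => hsurj fun t => ?_⟩
    obtain ⟨u, hu⟩ : (e.symm t : L) ∈ Set.range fun t => (e.symm (f t) : L) :=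
      (Set.ext_iff.1 h _).2 (e.symm t).2
    exact ⟨u, e.symm.injective (Subtype.ext hu)⟩
  choose g hg using hsub
  obtain ⟨F, hF⟩ := exists_bool_coloring_of_map_lt g hg
  exact ⟨F, fun H hH => hF H (hH (g H) H (hg H).le subset_rfl)⟩
end

section
/- Let T be a scattered linear order containing a subset order-isomorphic to ℕᵒᵈ ×ₗ ℕ (the order type ωω*) or a subset order-isomorphic to ℕ ×ₗ ℕᵒᵈ (the order type ω*ω), and suppose that every infinite condensation class of T is order-isomorphic to ℕ. Then T has two consecutive condensation classes each order-isomorphic to ℕ: that is, there are condensation classes X and Y of T, each order-isomorphic to ℕ with the induced order, such that every element of X is less than every element of Y and no element of T lies strictly between an element of X and an element of Y while belonging to neither. -/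
/-- The condensation class (under the finite condensation) of `x` in a linear order:
the set of `y` such that only finitely many elements lie (inclusively) between `x`
and `y`. -/
def condClass {T : Type*} [LinearOrder T] (x : T) : Set T :=
  {y | {z | (x ≤ z ∧ z ≤ y) ∨ (y ≤ z ∧ z ≤ x)}.Finite}

section FiniteCondensation

open Set

variable {T : Type*} [LinearOrder T]

theorem mem_condClass_iff {x y : T} :
    y ∈ condClass x ↔ (Icc x y).Finite ∧ (Icc y x).Finite := by
  rw [← Set.finite_union]
  rfl

theorem mem_condClass_iff_of_le {x y : T} (h : x ≤ y) :
    y ∈ condClass x ↔ (Icc x y).Finite := by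
  rw [mem_condClass_iff, and_iff_left_iff_imp]
  exact fun _ ↦ (Set.finite_singleton x).subset fun z hz ↦ le_antisymm hz.2 (h.trans hz.1)

theorem mem_condClass_self (x : T) : x ∈ condClass x := by
  simp [mem_condClass_iff]

theorem mem_condClass_comm {x y : T} : y ∈ condClass x ↔ x ∈ condClass y := by
  rw [mem_condClass_iff, mem_condClass_iff, and_comm]

theorem mem_condClass_trans {x y z : T} (hxy : y ∈ condClass x) (hyz : z ∈ condClass y) :
    z ∈ condClass x := by
  rw [mem_condClass_iff] at *
  exact ⟨(hxy.1.union hyz.1).subset Icc_subset_Icc_union_Icc,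
    (hyz.2.union hxy.2).subset Icc_subset_Icc_union_Icc⟩

theorem mem_condClass_of_mem_Icc {x y z : T} (hz : z ∈ Icc x y) (h : y ∈ condClass x) :
    z ∈ condClass x := by
  rw [mem_condClass_iff_of_le (hz.1.trans hz.2)] at h
  rw [mem_condClass_iff_of_le hz.1]
  exact h.subset (Icc_subset_Icc_right hz.2)

theorem lt_of_mem_condClass {a b a' b' : T} (hab : a < b) (h : b ∉ condClass a)
    (ha : a' ∈ condClass a) (hb : b' ∈ condClass b) : a' < b' := by
  by_contra! hle
  rcases le_total a b' with h1 | h1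
  · exact h (mem_condClass_trans (mem_condClass_of_mem_Icc ⟨h1, hle⟩ ha) (mem_condClass_comm.1 hb))
  · have hb' := mem_condClass_comm.1 hb
    have := mem_condClass_of_mem_Icc ⟨h1, hab.le⟩ hb'
    exact h (mem_condClass_trans (mem_condClass_comm.1 this) hb')

variable (T) in
theorem exists_condClass_transversal :
    ∃ S : Set T, (∀ x : T, ∃ s ∈ S, s ∈ condClass x) ∧
      ∀ s ∈ S, ∀ t ∈ S, t ∈ condClass s → s = t := by
  let r : Setoid T := ⟨fun x y ↦ y ∈ condClass x,
    ⟨mem_condClass_self, mem_condClass_comm.1, mem_condClass_trans⟩⟩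
  refine ⟨range (Quotient.out : Quotient r → T), fun x ↦ ?_, ?_⟩
  · exact ⟨_, mem_range_self (Quotient.mk r x), r.symm (Quotient.mk_out (s := r) x)⟩
  · rintro _ ⟨s, rfl⟩ _ ⟨t, rfl⟩ h
    exact congrArg _ (Quotient.out_equiv_out.1 h)

theorem exists_covBy_of_finite_Icc {a c : T} (hac : a < c) (h : (Icc a c).Finite) :
    ∃ b, a ⋖ b ∧ b ≤ c := by
  obtain ⟨b, hb, hmin⟩ := Set.exists_min_image (Ioc a c) id
    (h.subset Ioc_subset_Icc_self) ⟨c, hac, le_rfl⟩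
  exact ⟨b, ⟨hb.1, fun z hz hzb ↦ (hmin z ⟨hz, hzb.le.trans hb.2⟩).not_gt hzb⟩, hb.2⟩

theorem finite_condClass_of_forall_covBy (h : ∀ a b c : T, a ⋖ b → ¬ b ⋖ c) (x : T) :
    (condClass x).Finite := by
  have key : ∀ a b c : T, a < b → b < c → c ∉ condClass a := by
    intro a b c hab hbc hc
    rw [mem_condClass_iff_of_le (hab.trans hbc).le] at hc
    obtain ⟨b', hb', hle⟩ :=
      exists_covBy_of_finite_Icc hab (hc.subset (Icc_subset_Icc_right hbc.le))
    obtain ⟨c', hc', -⟩ := exists_covBy_of_finite_Icc (hle.trans_lt hbc)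
      (hc.subset (Icc_subset_Icc_left hb'.le))
    exact h _ _ _ hb' hc'
  have hr : (condClass x ∩ Ioi x).Subsingleton := by
    rintro y ⟨hy, hxy⟩ z ⟨hz, hxz⟩
    rcases lt_trichotomy y z with hlt | rfl | hlt
    · exact absurd hz (key _ _ _ hxy hlt)
    · rfl
    · exact absurd hy (key _ _ _ hxz hlt)
  have hl : (condClass x ∩ Iio x).Subsingleton := by
    rintro y ⟨hy, hxy⟩ z ⟨hz, hxz⟩
    rcases lt_trichotomy y z with hlt | rfl | hlt
    · exact absurd (mem_condClass_comm.1 hy) (key _ _ _ hlt hxz)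
    · rfl
    · exact absurd (mem_condClass_comm.1 hz) (key _ _ _ hlt hxy)
  refine ((hr.finite.union hl.finite).union (finite_singleton x)).subset fun y hy ↦ ?_
  rcases lt_trichotomy y x with hlt | rfl | hlt
  · exact .inl (.inr ⟨hy, hlt⟩)
  · exact .inr rfl
  · exact .inl (.inl ⟨hy, hlt⟩)

/-- An infinite linear order whose condensation classes are all finite contains a copy of `ℚ`. -/
theorem nonempty_rat_orderEmbedding_of_finite_condClass [Infinite T]
    (h : ∀ x : T, (condClass x).Finite) : Nonempty (ℚ ↪o T) := by
  obtain ⟨S, hS, hinj⟩ := exists_condClass_transversal T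
  have hdense : DenselyOrdered S := by
    refine ⟨fun ⟨s, hs⟩ ⟨t, ht⟩ hst ↦ ?_⟩
    have hst' : s < t := hst
    have hnot : t ∉ condClass s := fun hc ↦ hst'.ne (hinj s hs t ht hc)
    have hinf : (Icc s t).Infinite := fun hf ↦ hnot ((mem_condClass_iff_of_le hst'.le).2 hf)
    obtain ⟨z, hz, hzn⟩ := (hinf.sdiff ((h s).union (h t))).nonempty
    rw [mem_union, not_or] at hzn
    obtain ⟨r, hr, hrz⟩ := hS z
    have hsz : s < z := hz.1.lt_of_ne fun he ↦ hzn.1 (he ▸ mem_condClass_self s)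
    have hzt : z < t := hz.2.lt_of_ne fun he ↦ hzn.2 (he ▸ mem_condClass_self t)
    have hsr : s < r := lt_of_mem_condClass hsz hzn.1 (mem_condClass_self s) hrz
    have hrt : r < t := lt_of_mem_condClass hzt (fun hc ↦ hzn.2 (mem_condClass_comm.1 hc)) hrz
      (mem_condClass_self t)
    exact ⟨⟨r, hr⟩, hsr, hrt⟩
  have hnontriv : Nontrivial S := by
    obtain ⟨x⟩ : Nonempty T := inferInstance
    obtain ⟨y, hy⟩ := (h x).exists_notMem
    obtain ⟨r, hr, hrx⟩ := hS x
    obtain ⟨t, ht, hty⟩ := hS y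
    refine ⟨⟨r, hr⟩, ⟨t, ht⟩, fun he ↦ hy ?_⟩
    obtain rfl : r = t := congrArg Subtype.val he
    exact mem_condClass_trans hrx (mem_condClass_comm.1 hty)
  obtain ⟨f⟩ := Order.embedding_from_countable_to_dense ℚ S
  exact ⟨f.trans (OrderEmbedding.subtype _)⟩

theorem exists_isLeast_condClass
    (hcc : ∀ x : T, (condClass x).Infinite → Nonempty (condClass x ≃o ℕ)) (x : T) :
    ∃ m, IsLeast (condClass x) m := by
  by_cases hx : (condClass x).Infinite
  · obtain ⟨e⟩ := hcc x hx
    refine ⟨e.symm 0, (e.symm 0).2, fun y hy ↦ ?_⟩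
    have : e.symm 0 ≤ ⟨y, hy⟩ := e.symm_apply_le.2 (Nat.zero_le _)
    exact this
  · obtain ⟨m, hm, hmin⟩ := Set.exists_min_image (condClass x) id (not_infinite.1 hx)
      ⟨x, mem_condClass_self x⟩
    exact ⟨m, hm, hmin⟩

/-- If only finitely many classes occur, the well-foundedness of the classes excludes infinite
descending sequences. -/
theorem infinite_condClass_transversal_of_strictAnti
    (hcc : ∀ x : T, (condClass x).Infinite → Nonempty (condClass x ≃o ℕ))
    {f : ℕ → T} (hf : StrictAnti f) {S : Set T} (hS : ∀ x : T, ∃ s ∈ S, s ∈ condClass x) :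
    Infinite S := by
  by_contra hfin
  rw [not_infinite_iff_finite] at hfin
  choose r hrS hr using hS
  obtain ⟨s, hs⟩ := Finite.exists_infinite_fiber fun n ↦ (⟨r (f n), hrS _⟩ : S)
  rw [Set.infinite_coe_iff] at hs
  have hmem : ∀ n ∈ (fun n ↦ (⟨r (f n), hrS _⟩ : S)) ⁻¹' {s}, f n ∈ condClass s.1 := by
    intro n hn
    have : r (f n) = s.1 := congrArg Subtype.val hn
    exact this ▸ mem_condClass_comm.1 (hr (f n))
  obtain ⟨e⟩ := hcc s.1 ((hs.image hf.injective.injOn).mono (image_subset_iff.2 hmem))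
  obtain ⟨n, hn⟩ := hs.nonempty
  obtain ⟨m, hm⟩ := exists_isLeast_condClass hcc s.1
  have hfm : f n ∈ condClass m := mem_condClass_trans (mem_condClass_comm.1 hm.1) (hmem n hn)
  rw [mem_condClass_iff_of_le (hm.2 (hmem n hn))] at hfm
  refine (hs.sdiff (finite_Iio n)).image hf.injective.injOn (hfm.subset ?_)
  rintro _ ⟨k, ⟨hk, hkn⟩, rfl⟩
  exact ⟨hm.2 (hmem k hk), hf.antitone (not_lt.1 hkn)⟩

/-- No further class lies between the classes of consecutive elements of a transversal. -/
theorem mem_condClass_union_of_covBy {S : Set T} (hS : ∀ x : T, ∃ s ∈ S, s ∈ condClass x)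
    {a b : S} (hab : a ⋖ b) {z x y : T}
    (hx : x ∈ condClass a.1) (hy : y ∈ condClass b.1) (hxz : x ≤ z) (hzy : z ≤ y) :
    z ∈ condClass a.1 ∪ condClass b.1 := by
  obtain ⟨r, hr, hrz⟩ := hS z
  have hzr := mem_condClass_comm.1 hrz
  by_cases hra : r ∈ condClass a.1
  · exact .inl (mem_condClass_trans hra hzr)
  by_cases hrb : r ∈ condClass b.1
  · exact .inr (mem_condClass_trans hrb hzr)
  have har : a.1 < r := by
    by_contra! hle
    have hlt : r < a.1 := hle.lt_of_ne fun he ↦ hra (he ▸ mem_condClass_self _)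
    exact hxz.not_gt (lt_of_mem_condClass hlt (fun hc ↦ hra (mem_condClass_comm.1 hc)) hzr hx)
  have hrb' : r < b.1 := by
    by_contra! hle
    have hlt : b.1 < r := hle.lt_of_ne fun he ↦ hrb (he ▸ mem_condClass_self _)
    exact hzy.not_gt (lt_of_mem_condClass hlt hrb hy hzr)
  exact absurd hrb' (hab.2 (c := ⟨r, hr⟩) har)

/-- In a transversal, the class of an element with a successor is infinite. -/
theorem infinite_condClass_of_covBy
    (hcc : ∀ x : T, (condClass x).Infinite → Nonempty (condClass x ≃o ℕ))
    {S : Set T} (hS : ∀ x : T, ∃ s ∈ S, s ∈ condClass x)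
    (hinj : ∀ s ∈ S, ∀ t ∈ S, t ∈ condClass s → s = t) {a b : S} (hab : a ⋖ b) :
    (condClass a.1).Infinite := by
  intro hfin
  obtain ⟨y, hy⟩ := exists_isLeast_condClass hcc b.1
  have hlt : a.1 < b.1 := hab.1
  have hne : b.1 ∉ condClass a.1 := fun hc ↦ hlt.ne (hinj _ a.2 _ b.2 hc)
  have hay : a.1 < y := lt_of_mem_condClass hlt hne (mem_condClass_self _) hy.1
  refine hne (mem_condClass_trans (y := y) ?_ (mem_condClass_comm.1 hy.1))
  rw [mem_condClass_iff_of_le hay.le]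
  refine (hfin.union (finite_singleton y)).subset fun z hz ↦ ?_
  rcases mem_condClass_union_of_covBy hS hab (mem_condClass_self _) hy.1 hz.1 hz.2 with h | h
  · exact .inl h
  · exact .inr (le_antisymm hz.2 (hy.2 h))

theorem exists_strictAnti_of_orderIso {α : Type*} [Preorder α] {g : ℕ → α} (hg : StrictAnti g)
    {s : Set T} (e : s ≃o α) : ∃ f : ℕ → T, StrictAnti f :=
  ⟨fun n ↦ (e.symm (g n)).1, fun _ _ h ↦ e.symm.strictMono (hg h)⟩

end FiniteCondensation

/-- Claim 2 in the proof of Lemma 3.8: if `T` is a scattered linear order containing a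
copy of ωω* (`ℕᵒᵈ ×ₗ ℕ`) or of ω*ω (`ℕ ×ₗ ℕᵒᵈ`), and every infinite condensation class
of `T` is ordered as ℕ, then `T` has two consecutive condensation classes each ordered
as ℕ. -/
theorem stmt_11 {T : Type*} [LinearOrder T]
    (hscat : ∀ s : Set T, ¬ Nonempty (s ≃o ℚ))
    (hemb : (∃ s : Set T, Nonempty (s ≃o (ℕᵒᵈ ×ₗ ℕ))) ∨
            (∃ s : Set T, Nonempty (s ≃o (ℕ ×ₗ ℕᵒᵈ))))
    (hcc : ∀ x : T, (condClass x).Infinite → Nonempty (condClass x ≃o ℕ)) :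
    ∃ x y : T,
      Nonempty (condClass x ≃o ℕ) ∧ Nonempty (condClass y ≃o ℕ) ∧
      (∀ a ∈ condClass x, ∀ b ∈ condClass y, a < b) ∧
      (∀ z : T, (∃ a ∈ condClass x, a < z) → (∃ b ∈ condClass y, z < b) →
        z ∈ condClass x ∪ condClass y) := by
  obtain ⟨f, hf⟩ : ∃ f : ℕ → T, StrictAnti f := by
    rcases hemb with ⟨s, ⟨e⟩⟩ | ⟨s, ⟨e⟩⟩
    · exact exists_strictAnti_of_orderIso
        (g := fun n ↦ toLex (OrderDual.toDual n, 0))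
        (fun _ _ h ↦ Prod.Lex.toLex_lt_toLex.2 (.inl h)) e
    · exact exists_strictAnti_of_orderIso
        (g := fun n ↦ toLex (0, OrderDual.toDual n))
        (fun _ _ h ↦ by simpa [Prod.Lex.toLex_lt_toLex] using h) e
  obtain ⟨S, hS, hinj⟩ := exists_condClass_transversal T
  have := infinite_condClass_transversal_of_strictAnti hcc hf hS
  obtain ⟨a, b, c, hab, hbc⟩ : ∃ a b c : S, a ⋖ b ∧ b ⋖ c := by
    by_contra! h
    obtain ⟨g⟩ := nonempty_rat_orderEmbedding_of_finite_condClass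
      (finite_condClass_of_forall_covBy h)
    exact hscat _ ⟨(OrderEmbedding.orderIso (f := g.trans (OrderEmbedding.subtype _))).symm⟩
  have hlt : a.1 < b.1 := hab.1
  exact ⟨a, b, hcc _ (infinite_condClass_of_covBy hcc hS hinj hab),
    hcc _ (infinite_condClass_of_covBy hcc hS hinj hbc),
    fun _ ha _ hb ↦
      lt_of_mem_condClass hlt (fun hc ↦ hlt.ne (hinj _ a.2 _ b.2 hc)) ha hb,
    fun _ ⟨_, hx, hxz⟩ ⟨_, hy, hzy⟩ ↦
      mem_condClass_union_of_covBy hS hab hx hy hxz.le hzy.le⟩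
end

section
/- Let R be a random graph, i.e. a simple graph on a countably infinite vertex type with the extension property. Let G be a simple graph equipped with a linear order on its vertex type, and suppose there is at least one copy of R in G. Then G ↛ (R)^R: there exists a function F from the copies of R in G to Bool such that no copy of R in G is homogeneous for F. -/
/-- Every two disjoint finite sets `s`, `t` of vertices admit a vertex outside `s ∪ t` adjacent
to every vertex of `s` and to no vertex of `t`. -/
def SimpleGraph.HasExtensionProperty {α : Type*} (G : SimpleGraph α) : Prop :=
  ∀ s t : Finset α, Disjoint s t →
    ∃ w : α, w ∉ s ∧ w ∉ t ∧ (∀ u ∈ s, G.Adj w u) ∧ (∀ v ∈ t, ¬ G.Adj w v)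

namespace SimpleGraph

variable {α β : Type*} {G : SimpleGraph α} {H : SimpleGraph β}

theorem HasExtensionProperty.of_iso (hH : H.HasExtensionProperty) (e : G ≃g H) :
    G.HasExtensionProperty := by
  intro s t hst
  obtain ⟨w, hws, hwt, hs, ht⟩ := hH (s.map e.toEquiv.toEmbedding) (t.map e.toEquiv.toEmbedding)
    ((Finset.disjoint_map _).2 hst)
  refine ⟨e.symm w, fun h ↦ hws ?_, fun h ↦ hwt ?_, fun u hu ↦ ?_, fun v hv hadj ↦ ?_⟩
  · exact Finset.mem_map.2 ⟨_, h, e.apply_symm_apply w⟩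
  · exact Finset.mem_map.2 ⟨_, h, e.apply_symm_apply w⟩
  · rw [← e.map_adj_iff, e.apply_symm_apply]
    exact hs _ (Finset.mem_map_of_mem _ hu)
  · rw [← e.map_adj_iff, e.apply_symm_apply] at hadj
    exact ht _ (Finset.mem_map_of_mem _ hv) hadj

theorem HasExtensionProperty.induce_diff_singleton {S : Set α}
    (hS : (G.induce S).HasExtensionProperty) (a : S) :
    (G.induce (S \ {(a : α)})).HasExtensionProperty := by
  classical
  intro s t hst
  let i : ↥(S \ {(a : α)}) ↪ S := ⟨Set.inclusion Set.sdiff_subset, Set.inclusion_injective _⟩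
  have hi : ∀ x, i x ≠ a := fun x h ↦ x.2.2 (congrArg Subtype.val h)
  obtain ⟨w, hws, hwt, hs, ht⟩ := hS (s.map i) (insert a (t.map i)) (by
    rw [Finset.disjoint_insert_right, Finset.disjoint_map]
    refine ⟨fun h ↦ ?_, hst⟩
    obtain ⟨x, -, hx⟩ := Finset.mem_map.1 h
    exact hi x hx)
  rw [Finset.mem_insert, not_or] at hwt
  refine ⟨⟨w, w.2, fun h ↦ hwt.1 (Subtype.ext h)⟩, fun h ↦ hws ?_, fun h ↦ hwt.2 ?_,
    fun u hu ↦ ?_, fun v hv ↦ ?_⟩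
  · exact Finset.mem_map_of_mem i h
  · exact Finset.mem_map_of_mem i h
  · exact hs _ (Finset.mem_map_of_mem i hu)
  · exact ht _ (Finset.mem_insert_of_mem (Finset.mem_map_of_mem i hv))

/-- The finite partial isomorphisms from `G` to `H`, as finite sets of pairs. -/
def FinitePartialIso (G : SimpleGraph α) (H : SimpleGraph β) : Type _ :=
  {f : Finset (α × β) // ∀ p ∈ f, ∀ q ∈ f,
    (p.1 = q.1 ↔ p.2 = q.2) ∧ (G.Adj p.1 q.1 ↔ H.Adj p.2 q.2)}

namespace FinitePartialIso

instance : PartialOrder (FinitePartialIso G H) :=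
  inferInstanceAs (PartialOrder (Subtype _))

instance : Inhabited (FinitePartialIso G H) :=
  ⟨⟨∅, by simp⟩⟩

/-- The inverse of a finite partial isomorphism. -/
def symm (f : FinitePartialIso G H) : FinitePartialIso H G :=
  ⟨f.1.map (Equiv.prodComm α β).toEmbedding, by
    intro p hp q hq
    rw [Finset.mem_map_equiv] at hp hq
    exact (f.2 _ hp _ hq).imp Iff.symm Iff.symm⟩

theorem mem_symm {f : FinitePartialIso G H} {p : β × α} : p ∈ f.symm.1 ↔ p.swap ∈ f.1 :=
  Finset.mem_map_equiv

theorem exists_le_mem_left (hH : H.HasExtensionProperty) (f : FinitePartialIso G H) (a : α) :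
    ∃ g, f ≤ g ∧ ∃ b, (a, b) ∈ g.1 := by
  classical
  by_cases ha : ∃ p ∈ f.1, p.1 = a
  · obtain ⟨⟨_, b⟩, hp, rfl⟩ := ha
    exact ⟨f, le_rfl, b, hp⟩
  push Not at ha
  obtain ⟨b, hbs, hbt, hs, ht⟩ := hH ({p ∈ f.1 | G.Adj a p.1}.image Prod.snd)
    ({p ∈ f.1 | ¬ G.Adj a p.1}.image Prod.snd) (by
      simp only [Finset.disjoint_left, Finset.mem_image, Finset.mem_filter]
      rintro _ ⟨p, ⟨hp, hpa⟩, rfl⟩ ⟨q, ⟨hq, hqa⟩, hqp⟩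
      exact hqa (((f.2 _ hq _ hp).1.2 hqp) ▸ hpa))
  have hb : ∀ p ∈ f.1, p.2 ≠ b := by
    rintro p hp rfl
    by_cases h : G.Adj a p.1
    · exact hbs (Finset.mem_image_of_mem _ (Finset.mem_filter.2 ⟨hp, h⟩))
    · exact hbt (Finset.mem_image_of_mem _ (Finset.mem_filter.2 ⟨hp, h⟩))
  have hadj : ∀ p ∈ f.1, (G.Adj a p.1 ↔ H.Adj b p.2) := by
    intro p hp
    by_cases h : G.Adj a p.1
    · exact iff_of_true h (hs _ (Finset.mem_image_of_mem _ (Finset.mem_filter.2 ⟨hp, h⟩)))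
    · exact iff_of_false h (ht _ (Finset.mem_image_of_mem _ (Finset.mem_filter.2 ⟨hp, h⟩)))
  refine ⟨⟨insert (a, b) f.1, ?_⟩, Finset.subset_insert _ _, b, Finset.mem_insert_self _ _⟩
  intro p hp q hq
  rcases Finset.mem_insert.1 hp with rfl | hp <;> rcases Finset.mem_insert.1 hq with rfl | hq
  · simp
  · exact ⟨iff_of_false (ha q hq).symm (hb q hq).symm, hadj q hq⟩
  · exact ⟨iff_of_false (ha p hp) (hb p hp), by
      rw [G.adj_comm, H.adj_comm]; exact hadj p hp⟩
  · exact f.2 p hp q hq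

theorem exists_le_mem_right (hG : G.HasExtensionProperty) (f : FinitePartialIso G H) (b : β) :
    ∃ g, f ≤ g ∧ ∃ a, (a, b) ∈ g.1 := by
  obtain ⟨g, hfg, a, hg⟩ := exists_le_mem_left hG f.symm b
  exact ⟨g.symm, fun p hp ↦ mem_symm.2 (hfg (mem_symm.2 hp)), a, mem_symm.2 hg⟩

end FinitePartialIso

/-- Any two countable graphs with the extension property are isomorphic. -/
theorem HasExtensionProperty.nonempty_iso [Countable α] [Countable β]
    (hG : G.HasExtensionProperty) (hH : H.HasExtensionProperty) : Nonempty (G ≃g H) := by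
  classical
  cases nonempty_encodable α
  cases nonempty_encodable β
  let D : α ⊕ β → Order.Cofinal (FinitePartialIso G H) := Sum.elim
    (fun a ↦ ⟨{f | ∃ b, (a, b) ∈ f.1}, fun f ↦ by
      obtain ⟨g, hfg, hg⟩ := f.exists_le_mem_left hH a
      exact ⟨g, hg, hfg⟩⟩)
    (fun b ↦ ⟨{f | ∃ a, (a, b) ∈ f.1}, fun f ↦ by
      obtain ⟨g, hfg, hg⟩ := f.exists_le_mem_right hG b
      exact ⟨g, hg, hfg⟩⟩)
  let I := Order.idealOfCofinals default D
  have hleft : ∀ a, ∃ b, ∃ f ∈ I, (a, b) ∈ f.1 := fun a ↦ by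
    obtain ⟨f, ⟨b, hb⟩, hf⟩ := Order.cofinal_meets_idealOfCofinals default D (Sum.inl a)
    exact ⟨b, f, hf, hb⟩
  have hright : ∀ b, ∃ a, ∃ f ∈ I, (a, b) ∈ f.1 := fun b ↦ by
    obtain ⟨f, ⟨a, ha⟩, hf⟩ := Order.cofinal_meets_idealOfCofinals default D (Sum.inr b)
    exact ⟨a, f, hf, ha⟩
  have key : ∀ p q : α × β, (∃ f ∈ I, p ∈ f.1) → (∃ f ∈ I, q ∈ f.1) →
      (p.1 = q.1 ↔ p.2 = q.2) ∧ (G.Adj p.1 q.1 ↔ H.Adj p.2 q.2) := by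
    rintro p q ⟨f, hf, hp⟩ ⟨g, hg, hq⟩
    obtain ⟨m, -, hfm, hgm⟩ := I.directed f hf g hg
    exact m.2 p (hfm hp) q (hgm hq)
  choose φ hφ using hleft
  choose ψ hψ using hright
  exact ⟨{
    toFun := φ
    invFun := ψ
    left_inv := fun a ↦ (key (ψ (φ a), φ a) (a, φ a) (hψ _) (hφ _)).1.2 rfl
    right_inv := fun b ↦ (key (ψ b, φ (ψ b)) (ψ b, b) (hφ _) (hψ _)).1.1 rfl
    map_rel_iff' := fun {a a'} ↦ (key (a, φ a) (a', φ a') (hφ _) (hφ _)).2.symm }⟩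

end SimpleGraph

open scoped symmDiff in
/-- The sets of elements of `α` can be coloured with two colours in such a way that removing one
element from a set always changes its colour. -/
theorem Set.exists_bool_coloring_diff_singleton_ne (α : Type*) :
    ∃ c : Set α → Bool, ∀ S : Set α, ∀ a ∈ S, c (S \ {a}) ≠ c S := by
  classical
  let r : Setoid (Set α) :=
    { r := fun S T ↦ (S ∆ T).Finite
      iseqv :=
        { refl := fun S ↦ by simp
          symm := fun {S T} h ↦ by rwa [symmDiff_comm]
          trans := fun {S T U} h h' ↦ (h.union h').subset (symmDiff_triangle S T U) } }
  let rep : Set α → Set α := fun S ↦ (Quotient.mk r S).out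
  have hrep : ∀ S, (S ∆ rep S).Finite := fun S ↦ r.symm (Quotient.mk_out (s := r) S)
  refine ⟨fun S ↦ decide (Even (S ∆ rep S).ncard), fun S a ha h ↦ ?_⟩
  have hrep_eq : rep (S \ {a}) = rep S := by
    refine congrArg Quotient.out (Quotient.sound (s := r) ?_)
    refine (Set.finite_singleton a).subset fun x hx ↦ ?_
    simp only [Set.mem_symmDiff, Set.mem_sdiff, Set.mem_singleton_iff] at hx ⊢
    tauto
  have hfin := hrep S
  have hfin' := hrep (S \ {a})
  rw [decide_eq_decide] at h
  rw [hrep_eq] at h hfin'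
  by_cases har : a ∈ rep S
  · have heq : (S \ {a}) ∆ rep S = insert a (S ∆ rep S) := by
      ext x
      by_cases hx : x = a <;> simp [Set.mem_symmDiff, hx, ha, har]
    rw [heq, Set.ncard_insert_of_notMem (by simp [Set.mem_symmDiff, ha, har]) hfin,
      Nat.even_add_one] at h
    tauto
  · have heq : S ∆ rep S = insert a ((S \ {a}) ∆ rep S) := by
      ext x
      by_cases hx : x = a <;> simp [Set.mem_symmDiff, hx, ha, har]
    rw [heq, Set.ncard_insert_of_notMem (by simp [Set.mem_symmDiff, har]) hfin',
      Nat.even_add_one] at h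
    tauto

/-- Proposition 3.9: if `R` is a random graph (countably infinite with the extension
property) and `G` is a simple graph whose vertex type carries a linear order and which
contains at least one copy of `R` (a set of vertices inducing a subgraph isomorphic
to `R`), then `G ↛ (R)^R`: there is a colouring of the copies of `R` in `G` with no
homogeneous copy. -/
theorem stmt_13 {V W : Type*} [Countable V] [Infinite V] (R : SimpleGraph V)
    (hext : ∀ U U' : Finset V, Disjoint U U' →
      ∃ w : V, w ∉ U ∧ w ∉ U' ∧ (∀ u ∈ U, R.Adj w u) ∧ (∀ v ∈ U', ¬ R.Adj w v))
    [LinearOrder W] (G : SimpleGraph W)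
    (hcopy : ∃ S : Set W, Nonempty (G.induce S ≃g R)) :
    ∃ F : {S : Set W // Nonempty (G.induce S ≃g R)} → Bool,
      ∀ H : {S : Set W // Nonempty (G.induce S ≃g R)},
        ¬ ∀ Y Z : {S : Set W // Nonempty (G.induce S ≃g R)},
          (Y : Set W) ⊆ (H : Set W) → (Z : Set W) ⊆ (H : Set W) → F Y = F Z := by
  have hR : R.HasExtensionProperty := hext
  obtain ⟨c, hc⟩ := Set.exists_bool_coloring_diff_singleton_ne W
  refine ⟨fun S ↦ c S, fun ⟨S, ⟨e⟩⟩ hom ↦ ?_⟩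
  have hS : (G.induce S).HasExtensionProperty := hR.of_iso e
  obtain ⟨a, -⟩ := hS ∅ ∅ (Finset.disjoint_empty_left _)
  have : Countable S := e.toEquiv.countable_iff.2 inferInstance
  have : Countable ↥(S \ {(a : W)}) := (Set.inclusion_injective Set.sdiff_subset).countable
  exact hc S a a.2 (hom ⟨S \ {(a : W)}, (hS.induce_diff_singleton a).nonempty_iso hR⟩ ⟨S, ⟨e⟩⟩
    Set.sdiff_subset subset_rfl)
end

section
/- Let α be a well-ordered type and let x : ℕ → ^α2 be a sequence that is either strictly increasing or strictly decreasing with respect to the lexicographic order. Then there exists a strictly increasing g : ℕ → ℕ such that the sequence n ↦ δ(x(g(n)), x(g(n+1))) is strictly increasing, where δ(u,v) denotes the least index at which u and v differ. -/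
/-- If all members of a sequence in `^α2` split in the same direction, some subsequence has
strictly increasing consecutive splitting indices. -/
theorem exists_canonised_subsequence {α : Type*} [LinearOrder α] [WellFoundedLT α]
    (y : ℕ → α → Bool) (b : Bool)
    (hy : ∀ m n, m < n → ∃ i, (∀ j < i, y m j = y n j) ∧ y m i = b ∧ y n i = !b) :
    ∃ g : ℕ → ℕ, StrictMono g ∧
      ∃ d : ℕ → α,
        (∀ n : ℕ, IsLeast {i : α | y (g n) i ≠ y (g (n + 1)) i} (d n)) ∧
        StrictMono d := by
  choose δ agree left right using hy
  have attained : ∀ m, ∃ n, ∃ h : m < n, ∀ k (hk : m < k), δ m n h ≤ δ m k hk := by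
    intro m
    have : Nonempty (Set.Ioi m) := ⟨⟨m + 1, Nat.lt_succ_self m⟩⟩
    let f : Set.Ioi m → α := fun k => δ m k k.2
    exact ⟨(Function.argmin f).1, (Function.argmin f).2, fun k hk => Function.argmin_le f ⟨k, hk⟩⟩
  choose s hs hmin using attained
  have step : ∀ m, δ m (s m) (hs m) < δ (s m) (s (s m)) (hs (s m)) := by
    intro m
    set i := δ (s m) (s (s m)) (hs (s m)) with hi
    have hl : y (s m) i = b := left _ _ _
    have hr : y (s (s m)) i = !b := right _ _ _
    by_contra! hle
    rcases hle.lt_or_eq with hlt | heq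
    · have h₁ := agree m (s m) (hs m) i hlt
      have h₂ := agree m (s (s m)) ((hs m).trans (hs _)) i (hlt.trans_le (hmin m _ _))
      simp_all
    · have h₁ := right m (s m) (hs m)
      rw [← heq, hl] at h₁
      simp at h₁
  refine ⟨fun n => s^[n] 0, strictMono_nat_of_lt_succ fun n => ?_,
    fun n => δ (s^[n] 0) (s (s^[n] 0)) (hs _), fun n => ?_,
    strictMono_nat_of_lt_succ fun n => ?_⟩
  · simpa only [Function.iterate_succ_apply'] using hs _
  · simp only [Function.iterate_succ_apply']
    refine ⟨?_, fun j hj => not_lt.1 fun hlt => hj (agree _ _ _ j hlt)⟩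
    rw [Set.mem_ofPred_eq, left, right]
    simp
  · simpa only [Function.iterate_succ_apply'] using step _

/-- The canonisation observation: for a sequence in `^α2` (`Lex (α → Bool)` with the
lexicographic order, `α` well-ordered) that is strictly increasing or strictly
decreasing, there is a subsequence whose consecutive splitting indices
`δ(x₀,x₁) < δ(x₁,x₂) < …` (least indices of disagreement) are strictly increasing. -/
theorem stmt_16 {α : Type*} [LinearOrder α] [WellFoundedLT α]
    (x : ℕ → Lex (α → Bool)) (hx : StrictMono x ∨ StrictAnti x) :
    ∃ g : ℕ → ℕ, StrictMono g ∧
      ∃ d : ℕ → α,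
        (∀ n : ℕ, IsLeast {i : α | ofLex (x (g n)) i ≠ ofLex (x (g (n + 1))) i} (d n)) ∧
        StrictMono d := by
  rcases hx with hx | hx
  · refine exists_canonised_subsequence (fun n => ofLex (x n)) false fun m n hmn => ?_
    obtain ⟨i, agree, hlt⟩ := hx hmn
    exact ⟨i, agree, Bool.lt_iff.1 hlt⟩
  · refine exists_canonised_subsequence (fun n => ofLex (x n)) true fun m n hmn => ?_
    obtain ⟨i, agree, hlt⟩ := hx hmn
    exact ⟨i, fun j hj => (agree j hj).symm, (Bool.lt_iff.1 hlt).symm⟩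
end
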